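/- arXiv:2004.06644 — 6 statements merged into one kernel-verified Lean document; each statement's English description precedes it below -/
import Mathlib

section
/- Let X and Y be real-valued random variables on a common probability space whose distributions are atomless (continuous CDFs), let F_X(x) = P(X ≤ x), F_Y(y) = P(Y ≤ y), and let s be a real number. Then sup over x ∈ ℝ of max(F_X(x) + F_Y(s − x) − 1, 0) ≤ P(X + Y < s) ≤ inf over x ∈ ℝ of min(F_X(x) + F_Y(s − x), 1). -/
open MeasureTheory

/-- Theorem 1 of the paper for `L(x,y) = x + y`: for random variables `X`, `Y`
with atomless distributions and arbitrary dependence, the CDF of `X + Y` at `s`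
is sandwiched between `sup_x max(F_X x + F_Y (s-x) - 1, 0)` and
`inf_x min(F_X x + F_Y (s-x), 1)`. -/
theorem frechet_bounds_cdf_sum
    {Ω : Type*} [MeasurableSpace Ω] (μ : Measure Ω) [IsProbabilityMeasure μ]
    (X Y : Ω → ℝ) (hX : Measurable X) (hY : Measurable Y)
    (hXatomless : ∀ c : ℝ, μ {ω | X ω = c} = 0)
    (hYatomless : ∀ c : ℝ, μ {ω | Y ω = c} = 0) (s : ℝ) :
    (⨆ x : ℝ, max ((μ {ω | X ω ≤ x}).toReal + (μ {ω | Y ω ≤ s - x}).toReal - 1) 0)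
        ≤ (μ {ω | X ω + Y ω < s}).toReal ∧
      (μ {ω | X ω + Y ω < s}).toReal
        ≤ ⨅ x : ℝ, min ((μ {ω | X ω ≤ x}).toReal + (μ {ω | Y ω ≤ s - x}).toReal) 1 := by
  constructor
  · refine ciSup_le fun x => max_le ?_ ENNReal.toReal_nonneg
    have hB : MeasurableSet {ω | Y ω ≤ s - x} := hY measurableSet_Iic
    have h1 := measureReal_union_add_inter (μ := μ) (s := {ω | X ω ≤ x}) hB
    have h2 : μ.real ({ω | X ω ≤ x} ∪ {ω | Y ω ≤ s - x}) ≤ 1 := measureReal_le_one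
    have h3 : μ.real ({ω | X ω ≤ x} ∩ {ω | Y ω ≤ s - x}) ≤
        μ.real ({ω | X ω + Y ω < s} ∪ {ω | X ω = x}) := by
      refine measureReal_mono ?_ (measure_ne_top _ _)
      rintro ω ⟨ha, hb⟩
      simp only [Set.mem_ofPred_eq, Set.mem_union] at *
      rcases ha.lt_or_eq with h | h
      · left; linarith
      · right; exact h
    have h4 := measureReal_union_le (μ := μ) {ω | X ω + Y ω < s} {ω | X ω = x}
    have h5 : μ.real {ω | X ω = x} = 0 := by simp [Measure.real, hXatomless x]
    simp only [Measure.real] at *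
    linarith
  · refine le_ciInf fun x => le_min ?_ measureReal_le_one
    refine le_trans ?_ (measureReal_union_le (μ := μ) {ω | X ω ≤ x} {ω | Y ω ≤ s - x})
    refine measureReal_mono ?_ (measure_ne_top _ _)
    intro ω h
    simp only [Set.mem_ofPred_eq, Set.mem_union] at *
    by_contra! hc
    linarith [hc.1, hc.2]
end

section
/- Let X and Y be real-valued random variables on a common probability space with atomless distributions, let F_X(x) = P(X ≤ x), F_Y(y) = P(Y ≤ y), and let s ≤ t be real numbers.ated Then for every y ≤ s − t: F_X(s − y) + F_Y(y) − 1 ≤ P(X < t or X + Y < s) ≤ F_X(s − y) + F_Y(y), and moreover F_X(t) ≤ P(X < t or X + Y < s) ≤ F_X(t) + F_Y(s − t). -/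
open MeasureTheory

/-- Validity direction of Theorems 4 and 5 of the paper: the probability of the
secrecy outage event `{X < t} ∪ {X + Y < s}` (no CSIT) under any joint
distribution lies between the Fréchet-type bounds evaluated on the boundary. -/
theorem frechet_bounds_outage_no_csit
    {Ω : Type*} [MeasurableSpace Ω] (μ : Measure Ω) [IsProbabilityMeasure μ]
    (X Y : Ω → ℝ) (hX : Measurable X) (hY : Measurable Y)
    (hXatomless : ∀ c : ℝ, μ {ω | X ω = c} = 0)
    (hYatomless : ∀ c : ℝ, μ {ω | Y ω = c} = 0)
    (s t : ℝ) (hst : s ≤ t) :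
    (∀ y ≤ s - t,
        (μ {ω | X ω ≤ s - y}).toReal + (μ {ω | Y ω ≤ y}).toReal - 1
            ≤ (μ {ω | X ω < t ∨ X ω + Y ω < s}).toReal ∧
          (μ {ω | X ω < t ∨ X ω + Y ω < s}).toReal
            ≤ (μ {ω | X ω ≤ s - y}).toReal + (μ {ω | Y ω ≤ y}).toReal) ∧
      (μ {ω | X ω ≤ t}).toReal ≤ (μ {ω | X ω < t ∨ X ω + Y ω < s}).toReal ∧
      (μ {ω | X ω < t ∨ X ω + Y ω < s}).toReal
        ≤ (μ {ω | X ω ≤ t}).toReal + (μ {ω | Y ω ≤ s - t}).toReal := by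
  have upper : ∀ y ≤ s - t, (μ {ω | X ω < t ∨ X ω + Y ω < s}).toReal
      ≤ (μ {ω | X ω ≤ s - y}).toReal + (μ {ω | Y ω ≤ y}).toReal := by
    intro y hy
    refine le_trans (measureReal_mono (μ := μ)
      (s₂ := {ω | X ω ≤ s - y} ∪ {ω | Y ω ≤ y}) ?_) (measureReal_union_le _ _)
    intro ω h
    simp only [Set.mem_union, Set.mem_setOf_eq] at h ⊢
    by_contra! hc
    rcases h with h | h <;> linarith [hc.1, hc.2]
  have lower : ∀ (c : ℝ) (A : Set Ω),
      A ⊆ {ω | X ω < t ∨ X ω + Y ω < s} ∪ {ω | X ω = c} →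
      (μ A).toReal ≤ (μ {ω | X ω < t ∨ X ω + Y ω < s}).toReal := by
    intro c A hA
    refine ENNReal.toReal_mono (measure_ne_top _ _) ?_
    calc μ A ≤ _ := measure_mono hA
      _ ≤ _ := measure_union_le _ _
      _ = _ := by rw [hXatomless c, add_zero]
  refine ⟨fun y hy => ⟨?_, upper y hy⟩, ?_, ?_⟩
  · have h1 := lower (s - y) ({ω | X ω ≤ s - y} ∩ {ω | Y ω ≤ y}) (by
      rintro ω ⟨h1, h2⟩
      simp only [Set.mem_union, Set.mem_setOf_eq] at h1 h2 ⊢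
      rcases h1.lt_or_eq with h | h
      · left; right; linarith
      · right; exact h)
    have h2 := measureReal_union_add_inter (μ := μ) (s := {ω | X ω ≤ s - y})
      (t := {ω | Y ω ≤ y}) (hY measurableSet_Iic)
    have h3 : μ.real ({ω | X ω ≤ s - y} ∪ {ω | Y ω ≤ y}) ≤ 1 := measureReal_le_one
    simp only [Measure.real] at h2 h3
    linarith
  · refine lower t _ ?_
    intro ω h
    simp only [Set.mem_union, Set.mem_setOf_eq] at h ⊢
    rcases h.lt_or_eq with h | h
    · left; left; exact h
    · right; exact h
  · have := upper (s - t) le_rfl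
    rwa [sub_sub_cancel] at this
end

section
/- Let a, b, s > 0. Then the supremum over y ≤ 0 of max( exp(b·y) − exp(a·(y − s)), 0 ) equals: exp(b·y*) − exp(a·(y* − s)) with y* = (a·s + log(b/a))/(a − b), if b < a·exp(−a·s); and 1 − exp(−a·s) otherwise. -/
theorem aux_bern (a b t : ℝ) (hb : 0 < b) (hab : b ≤ a) :
    a * (Real.exp (b * t) - 1) ≤ b * (Real.exp (a * t) - 1) := by
  have h := one_add_mul_self_le_rpow_one_add (s := Real.exp (b * t) - 1)
    (by linarith [Real.exp_pos (b * t)]) (p := a / b) ((one_le_div hb).2 hab)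
  have e : (1 + (Real.exp (b * t) - 1)) ^ (a / b) = Real.exp (a * t) := by
    rw [add_sub_cancel, ← Real.exp_mul]
    congr 1
    field_simp
  rw [e] at h
  have h2 := mul_le_mul_of_nonneg_left h hb.le
  have h3 : b * (1 + a / b * (Real.exp (b * t) - 1)) = b + a * (Real.exp (b * t) - 1) := by
    field_simp
  linarith

theorem aux_sup (f : ℝ → ℝ) (y0 : ℝ) (h0 : y0 ≤ 0) (hf : 0 ≤ f y0)
    (h : ∀ y ≤ 0, f y ≤ f y0) :
    (⨆ y : {y : ℝ // y ≤ 0}, max (f (y : ℝ)) 0) = f y0 := by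
  have : Nonempty {y : ℝ // y ≤ 0} := ⟨⟨y0, h0⟩⟩
  apply le_antisymm
  · exact ciSup_le fun y => max_le (h y y.2) hf
  · refine le_ciSup_of_le ⟨f y0, ?_⟩ (⟨y0, h0⟩ : {y : ℝ // y ≤ 0}) (le_max_left _ _)
    rintro _ ⟨y, rfl⟩
    exact max_le (h y y.2) hf

/-- Explicit lower bound on the secrecy outage probability for Rayleigh fading
with perfect main-channel CSIT: `sup_{y ≤ 0} max(exp(b·y) − exp(a·(y−s)), 0)`
equals `exp(b·y*) − exp(a·(y*−s))` with `y* = (a·s + log(b/a))/(a−b)` if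
`b < a·exp(−a·s)`, and `1 − exp(−a·s)` otherwise. -/
theorem rayleigh_lower_bound_main_csit
    (a b s : ℝ) (ha : 0 < a) (hb : 0 < b) (hs : 0 < s) :
    (⨆ y : {y : ℝ // y ≤ 0},
        max (Real.exp (b * (y : ℝ)) - Real.exp (a * ((y : ℝ) - s))) 0) =
      if b < a * Real.exp (-(a * s)) then
        Real.exp (b * ((a * s + Real.log (b / a)) / (a - b))) -
          Real.exp (a * ((a * s + Real.log (b / a)) / (a - b) - s))
      else 1 - Real.exp (-(a * s)) := by
  split_ifs with hc
  · have hE : Real.exp (-(a * s)) < 1 := Real.exp_lt_one_iff.2 (by nlinarith [mul_pos ha hs])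
    have hab : b < a := by nlinarith
    have hl : Real.log (b / a) < -(a * s) := by
      rw [Real.log_lt_iff_lt_exp (div_pos hb ha), div_lt_iff₀ ha]
      linarith
    have hd : 0 < a - b := by linarith
    have hy : (a - b) * ((a * s + Real.log (b / a)) / (a - b)) = a * s + Real.log (b / a) := by
      field_simp
    have hy0 : (a * s + Real.log (b / a)) / (a - b) ≤ 0 :=
      div_nonpos_of_nonpos_of_nonneg (by linarith) hd.le
    generalize (a * s + Real.log (b / a)) / (a - b) = z at hy hy0 ⊢
    have hQ : Real.exp (a * (z - s)) = Real.exp (b * z) * (b / a) := by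
      rw [← Real.exp_log (div_pos hb ha), ← Real.exp_add]
      congr 1
      linarith
    have hQ' : a * Real.exp (a * (z - s)) = b * Real.exp (b * z) := by
      rw [hQ]
      field_simp
    have hP := Real.exp_pos (b * z)
    have hQp := Real.exp_pos (a * (z - s))
    refine aux_sup (fun y => Real.exp (b * y) - Real.exp (a * (y - s))) z hy0 ?_ ?_
    · show 0 ≤ Real.exp (b * z) - Real.exp (a * (z - s))
      nlinarith
    · intro y _
      have e1 : Real.exp (b * y) = Real.exp (b * z) * Real.exp (b * (y - z)) := by
        rw [← Real.exp_add]
        ring_nf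
      have e2 : Real.exp (a * (y - s)) = Real.exp (a * (z - s)) * Real.exp (a * (y - z)) := by
        rw [← Real.exp_add]
        ring_nf
      have hL := mul_le_mul_of_nonneg_left (aux_bern a b (y - z) hb hab.le) hP.le
      rw [e1, e2]
      generalize Real.exp (b * (y - z)) = u at *
      generalize Real.exp (a * (y - z)) = v at *
      generalize Real.exp (a * (z - s)) = Q at *
      generalize Real.exp (b * z) = P at *
      have h4 : a * (P * u - P) ≤ a * (Q * v - Q) := by
        calc a * (P * u - P) = P * (a * (u - 1)) := by ring
          _ ≤ P * (b * (v - 1)) := hL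
          _ = (b * P) * (v - 1) := by ring
          _ = (a * Q) * (v - 1) := by rw [hQ']
          _ = _ := by ring
      have := le_of_mul_le_mul_left h4 ha
      linarith
  · push Not at hc
    have hE : Real.exp (-(a * s)) < 1 := Real.exp_lt_one_iff.2 (by nlinarith [mul_pos ha hs])
    have hEp := Real.exp_pos (-(a * s))
    have h := aux_sup (fun y => Real.exp (b * y) - Real.exp (a * (y - s))) 0 le_rfl
    simp only [mul_zero, Real.exp_zero, zero_sub, mul_neg] at h
    apply h
    · linarith
    · intro y hy
      have e2 : Real.exp (a * (y - s)) = Real.exp (-(a * s)) * Real.exp (a * y) := by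
        rw [← Real.exp_add]
        ring_nf
      have hv : Real.exp (a * y) ≤ 1 := Real.exp_le_one_iff.2 (by nlinarith)
      rw [e2]
      rcases le_total b a with hab | hab
      · have hL := aux_bern a b y hb hab
        have h5 := mul_le_mul_of_nonneg_right hc (sub_nonneg.2 hv)
        have h6 : a * (Real.exp (b * y) - Real.exp (-(a * s)) * Real.exp (a * y))
            ≤ a * (1 - Real.exp (-(a * s))) := by linarith
        exact le_of_mul_le_mul_left h6 ha
      · have : Real.exp (b * y) ≤ Real.exp (a * y) := Real.exp_le_exp.2 (by nlinarith)
        nlinarith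
end

section
/- Let a, b, s > 0. Then the infimum over y ≤ 0 of min( 1 − exp(a·(y − s)) + exp(b·y), 1 ) equals: 1 if a ≥ b; and 1 − exp(a·(y* − s)) + exp(b·y*) with y* = (a·s + log(b/a))/(a − b), if a < b. -/
/-- Explicit upper bound on the secrecy outage probability for Rayleigh fading
with perfect main-channel CSIT:
`inf_{y ≤ 0} min(1 − exp(a·(y−s)) + exp(b·y), 1)` equals `1` if `a ≥ b`, and
`1 − exp(a·(y*−s)) + exp(b·y*)` with `y* = (a·s + log(b/a))/(a−b)` if `a < b`. -/
theorem rayleigh_upper_bound_main_csit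
    (a b s : ℝ) (ha : 0 < a) (hb : 0 < b) (hs : 0 < s) :
    (⨅ y : {y : ℝ // y ≤ 0},
        min (1 - Real.exp (a * ((y : ℝ) - s)) + Real.exp (b * (y : ℝ))) 1) =
      if a ≥ b then 1
      else
        1 - Real.exp (a * ((a * s + Real.log (b / a)) / (a - b) - s)) +
          Real.exp (b * ((a * s + Real.log (b / a)) / (a - b))) := by
  have : Nonempty {y : ℝ // y ≤ 0} := ⟨⟨0, le_refl 0⟩⟩
  split_ifs with hab
  · have h : ∀ y : {y : ℝ // y ≤ 0},
        min (1 - Real.exp (a * ((y : ℝ) - s)) + Real.exp (b * (y : ℝ))) 1 = 1 := by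
      intro y
      apply min_eq_right
      have : Real.exp (a * ((y : ℝ) - s)) ≤ Real.exp (b * (y : ℝ)) := by
        apply Real.exp_le_exp.2
        nlinarith [mul_nonneg (sub_nonneg.2 hab) (neg_nonneg.2 y.2), mul_pos ha hs]
      linarith
    simp only [h, ciInf_const]
  · have hlt : a < b := not_le.1 hab
    have hne : a - b ≠ 0 := by linarith
    have hlog : 0 < Real.log (b / a) := Real.log_pos ((one_lt_div ha).2 hlt)
    obtain ⟨z, hz⟩ : ∃ z, z = (a * s + Real.log (b / a)) / (a - b) := ⟨_, rfl⟩
    rw [← hz]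
    have hz0 : z ≤ 0 := by
      rw [hz]
      exact div_nonpos_of_nonneg_of_nonpos (by positivity) (by linarith)
    have hmul : z * (a - b) = a * s + Real.log (b / a) := by
      rw [hz]; field_simp
    have hE : Real.exp (a * (z - s)) = b / a * Real.exp (b * z) := by
      rw [show a * (z - s) = Real.log (b / a) + b * z by linarith, Real.exp_add,
        Real.exp_log (div_pos hb ha)]
    have hF := Real.exp_pos (b * z)
    have hba : 1 < b / a := (one_lt_div ha).2 hlt
    have hz1 : 1 - Real.exp (a * (z - s)) + Real.exp (b * z) ≤ 1 := by
      rw [hE]; nlinarith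
    have key : ∀ y : ℝ, 1 - Real.exp (a * (z - s)) + Real.exp (b * z) ≤
        1 - Real.exp (a * (y - s)) + Real.exp (b * y) := by
      intro y
      have hc := convexOn_exp.2 (Set.mem_univ (b * (y - z))) (Set.mem_univ 0)
        (show (0 : ℝ) ≤ a / b by positivity)
        (show (0 : ℝ) ≤ 1 - a / b by rw [sub_nonneg, div_le_one hb]; exact hlt.le) (by ring)
      simp only [smul_eq_mul, mul_zero, add_zero, Real.exp_zero, mul_one] at hc
      rw [show a / b * (b * (y - z)) = a * (y - z) by field_simp] at hc
      rw [show a * (y - s) = a * (z - s) + a * (y - z) by ring,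
        show b * y = b * z + b * (y - z) by ring, Real.exp_add, Real.exp_add, hE]
      have h2 := mul_le_mul_of_nonneg_left hc
        (mul_pos (div_pos hb ha) hF).le
      have h3 : b / a * Real.exp (b * z) *
          (a / b * Real.exp (b * (y - z)) + (1 - a / b)) =
          Real.exp (b * z) * Real.exp (b * (y - z)) + b / a * Real.exp (b * z)
            - Real.exp (b * z) := by
        field_simp
        ring
      linarith
    apply le_antisymm
    · refine (ciInf_le ?_ (⟨z, hz0⟩ : {y : ℝ // y ≤ 0})).trans (min_le_left _ _)
      refine ⟨1 - Real.exp (a * (z - s)) + Real.exp (b * z), ?_⟩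
      rintro _ ⟨y, rfl⟩
      exact le_min (key y) hz1
    · exact le_ciInf fun y => le_min (key y) hz1
end

section
/- Let X and Z be independent random variables where X is exponentially distributed with rate a > 0 and Z is exponentially distributed with rate b > 0, and let 0 ≤ s ≤ t. Then P( X < t or X < s + Z ) = 1 − exp(−a·t) + (a/(a + b))·exp(b·(s − t) − a·t). -/
open MeasureTheory ProbabilityTheory

lemma aux_exp_Iic {b : ℝ} (hb : 0 < b) {x : ℝ} (hx : 0 ≤ x) :
    expMeasure b (Set.Iic x) = ENNReal.ofReal (1 - Real.exp (-(b * x))) := by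
  have h := lintegral_exponentialPDF_eq_antiDeriv hb x
  rw [if_pos hx] at h
  rw [← h, expMeasure, gammaMeasure, withDensity_apply _ measurableSet_Iic]
  rfl

lemma aux_integral {a b : ℝ} (ha : 0 < a) (hb : 0 < b) (s t : ℝ) :
    IntegrableOn (fun x => a * Real.exp (-(a * x)) * (1 - Real.exp (-(b * (x - s))))) (Set.Ioi t) ∧
    ∫ x in Set.Ioi t, a * Real.exp (-(a * x)) * (1 - Real.exp (-(b * (x - s)))) =
      Real.exp (-(a * t)) - (a / (a + b)) * Real.exp (b * (s - t) - a * t) := by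
  have e : (fun x => a * Real.exp (-(a * x)) * (1 - Real.exp (-(b * (x - s))))) =
      fun x => a * Real.exp ((-a) * x) - (a * Real.exp (b * s)) * Real.exp ((-(a + b)) * x) := by
    funext x
    have : Real.exp (-(a * x)) * Real.exp (-(b * (x - s))) =
        Real.exp (b * s) * Real.exp ((-(a + b)) * x) := by
      rw [← Real.exp_add, ← Real.exp_add]; congr 1; ring
    rw [neg_mul a x]
    linear_combination (-a) * this
  have i1 := (integrableOn_exp_mul_Ioi (a := -a) (by linarith) t).const_mul a
  have i2 := (integrableOn_exp_mul_Ioi (a := -(a + b)) (by linarith) t).const_mul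
    (a * Real.exp (b * s))
  rw [e]
  refine ⟨i1.sub i2, ?_⟩
  rw [integral_sub i1 i2, integral_const_mul, integral_const_mul,
    integral_exp_mul_Ioi (by linarith), integral_exp_mul_Ioi (by linarith)]
  have : Real.exp (b * (s - t) - a * t) = Real.exp (b * s) * Real.exp ((-(a + b)) * t) := by
    rw [← Real.exp_add]; congr 1; ring
  rw [this, neg_mul a t]
  have : a + b ≠ 0 := by positivity
  field_simp

/-- Secrecy outage probability for independent Rayleigh fading with only
statistical CSIT: if `X ~ Exp(a)` and `Z ~ Exp(b)` are independent and
`0 ≤ s ≤ t`, then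
`P(X < t ∨ X < s + Z) = 1 − exp(−a·t) + (a/(a+b))·exp(b·(s−t) − a·t)`. -/
theorem rayleigh_independent_outage_no_csit
    {Ω : Type*} [MeasurableSpace Ω] (μ : Measure Ω) [IsProbabilityMeasure μ]
    (X Z : Ω → ℝ) (hX : Measurable X) (hZ : Measurable Z)
    (a b : ℝ) (ha : 0 < a) (hb : 0 < b)
    (hXexp : μ.map X = expMeasure a) (hZexp : μ.map Z = expMeasure b)
    (hindep : IndepFun X Z μ) (s t : ℝ) (hs : 0 ≤ s) (hst : s ≤ t) :
    (μ {ω | X ω < t ∨ X ω < s + Z ω}).toReal =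
      1 - Real.exp (-(a * t)) + (a / (a + b)) * Real.exp (b * (s - t) - a * t) := by
  haveI := isProbabilityMeasure_expMeasure ha
  haveI := isProbabilityMeasure_expMeasure hb
  set S : Set (ℝ × ℝ) := {p | t ≤ p.1 ∧ p.2 ≤ p.1 - s} with hS
  have mS : MeasurableSet S :=
    (measurableSet_le measurable_const measurable_fst).inter
      (measurableSet_le measurable_snd (measurable_fst.sub measurable_const))
  have hset : {ω | X ω < t ∨ X ω < s + Z ω} = ((fun ω => (X ω, Z ω)) ⁻¹' S)ᶜ := by
    ext ω
    simp only [hS, Set.mem_setOf_eq, Set.mem_compl_iff, Set.mem_preimage, not_and_or, not_le]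
    constructor <;> rintro (h | h)
    · exact Or.inl h
    · exact Or.inr (by linarith)
    · exact Or.inl h
    · exact Or.inr (by linarith)
  have hm := (indepFun_iff_map_prod_eq_prod_map_map hX.aemeasurable hZ.aemeasurable).1 hindep
  have hmS : μ ((fun ω => (X ω, Z ω)) ⁻¹' S) = (expMeasure a).prod (expMeasure b) S := by
    rw [← hXexp, ← hZexp, ← hm, Measure.map_apply (hX.prodMk hZ) mS]
  have hmeas : Measurable (exponentialPDF a) := (measurable_exponentialPDFReal a).ennreal_ofReal
  obtain ⟨hi, hI⟩ := aux_integral ha hb s t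
  have key : (expMeasure a).prod (expMeasure b) S = ENNReal.ofReal
      (Real.exp (-(a * t)) - (a / (a + b)) * Real.exp (b * (s - t) - a * t)) := by
    rw [Measure.prod_apply mS]
    have : expMeasure a = volume.withDensity (exponentialPDF a) := rfl
    rw [this, lintegral_withDensity_eq_lintegral_mul _ hmeas (measurable_measure_prodMk_left mS)]
    rw [← hI, ofReal_integral_eq_lintegral_ofReal hi, ← Measure.restrict_congr_set (Ioi_ae_eq_Ici (a := t)).symm,
      ← lintegral_indicator measurableSet_Ici]
    · congr 1
      funext x
      by_cases hx : t ≤ x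
      · rw [Set.indicator_of_mem (Set.mem_Ici.2 hx)]
        have : Prod.mk x ⁻¹' S = Set.Iic (x - s) := by
          ext z; simp [hS, hx]
        rw [Pi.mul_apply, this, aux_exp_Iic hb (by linarith),
          exponentialPDF_of_nonneg (by linarith), ← ENNReal.ofReal_mul (by positivity)]
      · rw [Set.indicator_of_notMem (by simpa using hx)]
        have : Prod.mk x ⁻¹' S = ∅ := by
          ext z; simp [hS, hx]
        simp [this]
    · filter_upwards [ae_restrict_mem measurableSet_Ioi] with x hx
      have hx' : t < x := hx
      have : Real.exp (-(b * (x - s))) ≤ 1 := by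
        rw [Real.exp_le_one_iff]
        have := mul_nonneg hb.le (show 0 ≤ x - s by linarith)
        linarith
      exact mul_nonneg (by positivity) (by linarith)
  have hnn : 0 ≤ Real.exp (-(a * t)) - (a / (a + b)) * Real.exp (b * (s - t) - a * t) := by
    have h1 : Real.exp (b * (s - t) - a * t) ≤ Real.exp (-(a * t)) := by
      apply Real.exp_le_exp.2
      have := mul_nonneg hb.le (show 0 ≤ t - s by linarith)
      linarith
    have h2 : a / (a + b) ≤ 1 := by
      rw [div_le_one (by positivity)]; linarith
    have := mul_le_mul h2 h1 (Real.exp_pos _).le zero_le_one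
    linarith
  rw [hset]
  change μ.real _ = _
  rw [probReal_compl_eq_one_sub ((hX.prodMk hZ) mS), Measure.real, hmS, key,
    ENNReal.toReal_ofReal hnn]
  ring
end

section
/- Let X and Y be real-valued random variables on a common probability space with atomless distributions, let F_X(x) = P(X ≤ x), F_Y(y) = P(Y ≤ y), let s ≤ t be real numbers, and let x̃ be any real number with s ≤ x̃ ≤ t. Then max( P(X + Y < s), P(Y < s − t), F_X(x̃) + F_Y(s − x̃) − 1 ) ≤ P( X + Y < s or Y < s − t ) ≤ min( F_X(t) + F_Y(s − t), F_X(x̃) + F_Y(s − x̃), 1 ). -/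
open MeasureTheory

/-- Validity direction of Theorem 6 of the paper (alternative secrecy outage
with perfect main-channel CSIT): for the union event
`{X + Y < s} ∪ {Y < s − t}` and any `x̃ ∈ [s, t]`, its probability is
sandwiched between the Fréchet-type lower and upper bounds. -/
theorem frechet_bounds_alt_outage_main_csit
    {Ω : Type*} [MeasurableSpace Ω] (μ : Measure Ω) [IsProbabilityMeasure μ]
    (X Y : Ω → ℝ) (hX : Measurable X) (hY : Measurable Y)
    (hXatomless : ∀ c : ℝ, μ {ω | X ω = c} = 0)
    (hYatomless : ∀ c : ℝ, μ {ω | Y ω = c} = 0)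
    (s t : ℝ) (hst : s ≤ t) (xt : ℝ) (hxt1 : s ≤ xt) (hxt2 : xt ≤ t) :
    max (max (μ {ω | X ω + Y ω < s}).toReal (μ {ω | Y ω < s - t}).toReal)
          ((μ {ω | X ω ≤ xt}).toReal + (μ {ω | Y ω ≤ s - xt}).toReal - 1)
        ≤ (μ {ω | X ω + Y ω < s ∨ Y ω < s - t}).toReal ∧
      (μ {ω | X ω + Y ω < s ∨ Y ω < s - t}).toReal
        ≤ min (min ((μ {ω | X ω ≤ t}).toReal + (μ {ω | Y ω ≤ s - t}).toReal)
              ((μ {ω | X ω ≤ xt}).toReal + (μ {ω | Y ω ≤ s - xt}).toReal)) 1 := by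
  have hup : ∀ a : ℝ, a ≤ t → (μ {ω | X ω + Y ω < s ∨ Y ω < s - t}).toReal
      ≤ (μ {ω | X ω ≤ a}).toReal + (μ {ω | Y ω ≤ s - a}).toReal := by
    intro a ha
    have h1 : μ.real {ω | X ω + Y ω < s ∨ Y ω < s - t}
        ≤ μ.real ({ω | X ω ≤ a} ∪ {ω | Y ω ≤ s - a}) := by
      refine measureReal_mono ?_ (measure_ne_top _ _)
      intro ω hω
      simp only [Set.mem_ofPred_eq, Set.mem_union] at hω ⊢
      by_contra! hc
      rcases hω with h | h <;> linarith [hc.1, hc.2]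
    exact h1.trans (measureReal_union_le _ _)
  refine ⟨max_le (max_le ?_ ?_) ?_, le_min (le_min (hup t le_rfl) (hup xt hxt2)) ?_⟩
  · exact measureReal_mono (μ := μ) (fun ω h => Or.inl h)
  · exact measureReal_mono (μ := μ) (fun ω h => Or.inr h)
  · have hB : MeasurableSet {ω | Y ω ≤ s - xt} := measurableSet_le hY measurable_const
    have h1 := measureReal_union_add_inter (μ := μ) (s := {ω | X ω ≤ xt}) hB
    have h2 : μ.real ({ω | X ω ≤ xt} ∪ {ω | Y ω ≤ s - xt}) ≤ 1 := measureReal_le_one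
    have h3 : μ.real ({ω | X ω ≤ xt} ∩ {ω | Y ω ≤ s - xt})
        ≤ μ.real ({ω | X ω + Y ω < s ∨ Y ω < s - t} ∪ {ω | X ω = xt}) := by
      refine measureReal_mono ?_ (measure_ne_top _ _)
      rintro ω ⟨ha, hb⟩
      simp only [Set.mem_ofPred_eq, Set.mem_union] at ha hb ⊢
      rcases ha.lt_or_eq with h | h
      · left; left; linarith
      · right; exact h
    have h4 := measureReal_union_le (μ := μ)
      {ω | X ω + Y ω < s ∨ Y ω < s - t} {ω | X ω = xt}
    have h5 : μ.real {ω | X ω = xt} = 0 := by simp [Measure.real, hXatomless xt]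
    change μ.real _ + μ.real _ - 1 ≤ μ.real _
    linarith
  · exact measureReal_le_one (μ := μ)
end
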